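/- Let d ≥ 1, T ≥ 1, λ > 0, and let φ₁, …, φ_T ∈ ℝ^d be arbitrary vectors. For each t ∈ {1, …, T+1} define Σ_t := λ·I_d + Σ_{i=1}^{t−1} φ_i φ_iᵀ. Then Σ_{t=1}^T min{φ_tᵀ Σ_t⁻¹ φ_t, 1} ≤ 2·log(det(Σ_{T+1}) / det(Σ₁)). -/

import Mathlib

open Finset Matrix

lemma aux_scalar (x : ℝ) (hx : 0 ≤ x) : min x 1 ≤ 2 * Real.log (1 + x) := by
  have hy0 : 0 ≤ min x 1 := le_min hx zero_le_one
  have hy1 : min x 1 ≤ 1 := min_le_right _ _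
  have hyx : min x 1 ≤ x := min_le_left _ _
  generalize min x 1 = y at *
  have h1 : Real.log (1 + y) ≤ Real.log (1 + x) :=
    Real.log_le_log (by linarith) (by linarith)
  have h2 := Real.one_sub_inv_le_log_of_pos (show 0 < 1 + y by linarith)
  have h3 : y / 2 ≤ 1 - (1 + y)⁻¹ := by
    have : 1 - (1 + y)⁻¹ = y / (1 + y) := by
      have : (1 + y) ≠ 0 := by linarith
      field_simp
      ring
    rw [this]
    exact div_le_div_of_nonneg_left hy0 (by linarith) (by linarith)
  linarith

lemma aux_pd (d : ℕ) (lam : ℝ) (hlam : 0 < lam) (φ : ℕ → Fin d → ℝ) (t : ℕ) :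
    (lam • (1 : Matrix (Fin d) (Fin d) ℝ) +
      ∑ i ∈ Finset.range t, vecMulVec (φ i) (φ i)).PosDef := by
  refine (Matrix.PosDef.one.smul hlam).add_posSemidef ?_
  refine Matrix.posSemidef_sum _ fun i _ => ?_
  simpa using posSemidef_vecMulVec_self_star (φ i)

lemma aux_det (d : ℕ) (A : Matrix (Fin d) (Fin d) ℝ) (hA : A.PosDef) (v : Fin d → ℝ) :
    (A + vecMulVec v v).det = A.det * (1 + v ⬝ᵥ A⁻¹.mulVec v) := by
  rw [vecMulVec_eq Unit, det_add_replicateCol_mul_replicateRow hA.det_pos.ne'.isUnit,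
    Matrix.mul_assoc, ← replicateCol_mulVec]
  simp [det_unique, Matrix.replicateRow_mul_replicateCol_apply]

theorem stmt11 (d T : ℕ) (hd : 1 ≤ d) (hT : 1 ≤ T)
    (lam : ℝ) (hlam : 0 < lam)
    (φ : ℕ → Fin d → ℝ) :
    ∑ t ∈ Finset.range T,
        min (φ t ⬝ᵥ
          (lam • (1 : Matrix (Fin d) (Fin d) ℝ) +
            ∑ i ∈ Finset.range t, vecMulVec (φ i) (φ i))⁻¹.mulVec (φ t)) 1 ≤
      2 * Real.log
        ((lam • (1 : Matrix (Fin d) (Fin d) ℝ) +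
            ∑ i ∈ Finset.range T, vecMulVec (φ i) (φ i)).det /
          (lam • (1 : Matrix (Fin d) (Fin d) ℝ)).det) := by
  clear hT
  have hpd := aux_pd d lam hlam φ
  have h0 := hpd 0
  simp only [Finset.range_zero, Finset.sum_empty, add_zero] at h0
  induction T with
  | zero => simp [div_self h0.det_pos.ne']
  | succ T ih =>
    rw [Finset.sum_range_succ, Finset.sum_range_succ _ T, ← add_assoc, aux_det d _ (hpd T)]
    have hx : 0 ≤ φ T ⬝ᵥ (lam • (1 : Matrix (Fin d) (Fin d) ℝ) +
            ∑ i ∈ Finset.range T, vecMulVec (φ i) (φ i))⁻¹.mulVec (φ T) := by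
      simpa using (hpd T).inv.posSemidef.dotProduct_mulVec_nonneg (φ T)
    have hs := aux_scalar _ hx
    rw [mul_div_right_comm, Real.log_mul (div_pos (hpd T).det_pos h0.det_pos).ne' (by linarith)]
    linarith
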